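/- arXiv:1711.01047 — 2 statements merged into one kernel-verified Lean document; each statement's English description precedes it below -/
import Mathlib

section
/- For every t ≥ 3 and every ε > 0, there exists k₀ such that for all k ≥ k₀ there is a set X of strings in [t]^k with |X| ≥ (t−1)^((((t−1)/t) − ε)·k) such that for any x, x' ∈ X (not necessarily distinct... for any two distinct x,x') and any letter a ∈ [t], there is a position i with x(i) ≠ x'(i), x(i) ≠ a and x'(i) ≠ a. -/
/-- Key lemma: on the grid `[n]^t`, fixing syndromes of class labels. -/
lemma grid_code (t n : ℕ) (T G : Type) [Fintype T] [DecidableEq T] [Fintype G] [DecidableEq G]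
    [AddCommGroup G] (cls : Fin t → T → G) :
    ∃ U : Finset ((Fin t → Fin n) → T),
      Fintype.card T ^ (n ^ t) ≤ U.card * Fintype.card G ^ ((n + 1) ^ t) ∧
      ∀ u ∈ U, ∀ u' ∈ U, u ≠ u' → ∀ a, ∃ p, u p ≠ u' p ∧ cls a (u p) = cls a (u' p) := by
  classical
  let s : Fin t → (Fin t → Fin n) → (Fin t → Fin (n + 1)) :=
    fun b p x => if x = b then (p x).castSucc else (p x).succ
  let syn : ((Fin t → Fin n) → T) → ((Fin t → Fin (n + 1)) → G) := fun u c =>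
    ∑ bq : Fin t × (Fin t → Fin n), if s bq.1 bq.2 = c then cls bq.1 (u bq.2) else 0
  have hne : (Finset.univ : Finset ((Fin t → Fin (n + 1)) → G)).Nonempty := Finset.univ_nonempty
  obtain ⟨z, -, hz⟩ := Finset.exists_max_image Finset.univ
    (fun z => (Finset.univ.filter (fun u => syn u = z)).card) hne
  refine ⟨Finset.univ.filter (fun u => syn u = z), ?_, ?_⟩
  · have h := Finset.card_le_mul_card_image_of_maps_to
      (s := (Finset.univ : Finset ((Fin t → Fin n) → T))) (t := Finset.univ) (f := syn)
      (fun _ _ => Finset.mem_univ _) _ (fun b _ => hz b (Finset.mem_univ b))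
    simpa [Fintype.card_fun] using h
  · intro u hu u' hu' hne a
    simp only [Finset.mem_filter, Finset.mem_univ, true_and] at hu hu'
    have hD : (Finset.univ.filter (fun p => u p ≠ u' p)).Nonempty := by
      obtain ⟨p, hp⟩ := Function.ne_iff.1 hne
      exact ⟨p, by simpa using hp⟩
    obtain ⟨p, hp, hmin⟩ := Finset.exists_min_image _ (fun p => p a) hD
    simp only [Finset.mem_filter, Finset.mem_univ, true_and] at hp hmin
    refine ⟨p, hp, ?_⟩
    have hs : syn u (s a p) = syn u' (s a p) := by rw [hu, hu']
    simp only [syn] at hs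
    rw [← Finset.add_sum_erase _ _ (Finset.mem_univ (a, p)),
      ← Finset.add_sum_erase _ _ (Finset.mem_univ (a, p))] at hs
    have h2 : ∀ bq ∈ (Finset.univ : Finset (Fin t × (Fin t → Fin n))).erase (a, p),
        (if s bq.1 bq.2 = s a p then cls bq.1 (u bq.2) else 0) =
        (if s bq.1 bq.2 = s a p then cls bq.1 (u' bq.2) else 0) := by
      rintro ⟨b, q⟩ hbq
      simp only [Finset.mem_erase, ne_eq, Prod.mk.injEq, Finset.mem_univ, and_true] at hbq
      by_cases hc : s b q = s a p
      · simp only [hc, if_true]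
        have : u q = u' q := by
          by_contra hq
          have hle := hmin q hq
          by_cases hba : b = a
          · subst hba
            apply hbq
            refine ⟨rfl, funext fun x => ?_⟩
            have := congrFun hc x
            simp only [s] at this
            split_ifs at this <;> simpa using this
          · have := congrFun hc a
            have hab : a ≠ b := fun h => hba h.symm
            simp only [s, hab, if_false, if_true] at this
            have := congrArg Fin.val this
            simp at this
            have h3 : (p a : ℕ) ≤ q a := hle
            omega
        rw [this]
      · simp [hc]
    rw [Finset.sum_congr rfl h2] at hs
    have hcancel := add_right_cancel hs
    simpa only [if_true] using hcancel

/-- Balanced strings. -/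
abbrev Bal (t r : ℕ) : Type :=
  {x : Fin t × Fin r → Fin t // ∀ a, (Finset.univ.filter (fun i => x i = a)).card = r}

lemma card_bal (t r : ℕ) : (t * r).factorial ≤ Fintype.card (Bal t r) * r.factorial ^ t := by
  classical
  let f : Equiv.Perm (Fin t × Fin r) → Bal t r := fun σ => ⟨fun i => (σ i).1, fun a => by
    have : (Finset.univ.filter (fun i => (σ i).1 = a)) =
        (Finset.univ.image (fun j : Fin r => σ.symm (a, j))) := by
      ext i
      simp only [Finset.mem_filter, Finset.mem_univ, true_and, Finset.mem_image]
      constructor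
      · rintro rfl
        exact ⟨(σ i).2, by simp⟩
      · rintro ⟨j, rfl⟩
        simp
    rw [this, Finset.card_image_of_injective]
    · simp
    · intro j j' h
      simpa using h⟩
  have hfib : ∀ x ∈ (Finset.univ : Finset (Bal t r)),
      (Finset.univ.filter (fun σ => f σ = x)).card ≤ r.factorial ^ t := by
    intro x _
    have hcard : Fintype.card ((a : Fin t) → ({i // x.1 i = a} ↪ Fin r)) = r.factorial ^ t := by
      rw [Fintype.card_pi]
      have : ∀ a : Fin t, Fintype.card ({i // x.1 i = a} ↪ Fin r) = r.factorial := by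
        intro a
        rw [Fintype.card_embedding_eq, Fintype.card_subtype, x.2 a, Fintype.card_fin,
          Nat.descFactorial_self]
      simp [this]
    rw [← hcard, ← Fintype.card_subtype]
    have hx : ∀ σ : {σ // f σ = x}, ∀ i, (σ.1 i).1 = x.1 i := fun σ i =>
      congrFun (congrArg Subtype.val σ.2) i
    refine Fintype.card_le_of_injective (fun σ a => ⟨fun i => (σ.1 i.1).2, ?_⟩) ?_
    · rintro ⟨i, hi⟩ ⟨j, hj⟩ hij
      apply Subtype.ext
      apply σ.1.injective
      exact Prod.ext (by rw [hx, hx, hi, hj]) hij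
    · intro σ τ h
      apply Subtype.ext
      ext1 i
      refine Prod.ext (by rw [hx, hx]) ?_
      have := congrFun h (x.1 i)
      exact DFunLike.congr_fun this ⟨i, rfl⟩
  have h := Finset.card_le_mul_card_image_of_maps_to
      (s := (Finset.univ : Finset (Equiv.Perm (Fin t × Fin r)))) (t := Finset.univ) (f := f)
      (fun _ _ => Finset.mem_univ _) _ hfib
  simpa [Fintype.card_perm, mul_comm] using h

lemma fact_bound (q : ℕ) (hq : 1 ≤ q) (r : ℕ) :
    q ^ (q * (r + 1)) * (r + 1).factorial ^ q ≤ (q * (r + 1)).factorial * (q * (r + 1)) ^ q := by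
  induction r with
  | zero =>
    simp
    exact Nat.le_mul_of_pos_left _ (Nat.factorial_pos q)
  | succ r ih =>
    have h1 : (q * (r + 1)).factorial * (q * (r + 1)) ^ q ≤ (q * (r + 1 + 1)).factorial := by
      have : q * (r + 1 + 1) = q * (r + 1) + q := by ring
      rw [this]
      refine le_trans (Nat.mul_le_mul_left _ ?_) Nat.factorial_mul_pow_le_factorial
      exact Nat.pow_le_pow_left (by omega) _
    calc q ^ (q * (r + 1 + 1)) * (r + 1 + 1).factorial ^ q
        = (q ^ (q * (r + 1)) * (r + 1).factorial ^ q) * (q * (r + 1 + 1)) ^ q := by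
          rw [Nat.factorial_succ (r + 1), mul_pow, mul_pow, mul_add q (r + 1) 1, pow_add]
          ring
      _ ≤ _ := Nat.mul_le_mul_right _ (ih.trans h1)

lemma bal_lower (t r : ℕ) (ht : 1 ≤ t) (hr : 1 ≤ r) :
    t ^ (t * r) ≤ Fintype.card (Bal t r) * (t * r) ^ t := by
  obtain ⟨r, rfl⟩ : ∃ s, r = s + 1 := ⟨r - 1, by omega⟩
  have h1 := fact_bound t ht r
  have h2 := card_bal t (r + 1)
  have h3 : 0 < (r + 1).factorial ^ t := pow_pos (Nat.factorial_pos _) _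
  refine Nat.le_of_mul_le_mul_right ?_ h3
  calc _ ≤ _ := h1
    _ ≤ _ := Nat.mul_le_mul_right _ h2
    _ = _ := by ring

lemma choose_bound (q m r : ℕ) (hr : r ≤ m) : m.choose r * q ^ (m - r) ≤ (q + 1) ^ m := by
  rw [add_comm, add_pow]
  have := Finset.single_le_sum (f := fun k => 1 ^ k * q ^ (m - k) * m.choose k)
    (s := Finset.range (m + 1)) (fun _ _ => Nat.zero_le _) (Finset.mem_range.2 (by omega : r < m + 1))
  refine le_trans (le_of_eq ?_) this
  simp [mul_comm]

def GoodCode {ι : Type} {t : ℕ} (X : Finset (ι → Fin t)) : Prop :=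
  ∀ x ∈ X, ∀ x' ∈ X, x ≠ x' → ∀ a : Fin t, ∃ i, x i ≠ x' i ∧ x i ≠ a ∧ x' i ≠ a

lemma base_code (t r n : ℕ) (ht : 1 ≤ t) :
    ∃ X : Finset ((Fin t → Fin n) × (Fin t × Fin r) → Fin t),
      Fintype.card (Bal t r) ^ (n ^ t) ≤ X.card * (t * r).choose r ^ ((n + 1) ^ t) ∧
      GoodCode X := by
  classical
  have hrm : r ≤ t * r := Nat.le_mul_of_pos_left _ ht
  have hN : 0 < (t * r).choose r := Nat.choose_pos hrm
  haveI : NeZero ((t * r).choose r) := ⟨hN.ne'⟩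
  let C := {S : Finset (Fin t × Fin r) // S.card = r}
  have hC : Fintype.card C = Fintype.card (ZMod ((t * r).choose r)) := by
    rw [Fintype.card_finset_len, ZMod.card]; simp
  let e : C ≃ ZMod ((t * r).choose r) := Fintype.equivOfCardEq hC
  obtain ⟨U, hU, hgood⟩ := grid_code t n (Bal t r) (ZMod ((t * r).choose r))
    (fun a x => e ⟨Finset.univ.filter (fun i => x.1 i = a), x.2 a⟩)
  let F : ((Fin t → Fin n) → Bal t r) → ((Fin t → Fin n) × (Fin t × Fin r) → Fin t) :=
    fun u pi => (u pi.1).1 pi.2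
  have hF : Function.Injective F := by
    intro u v h
    funext p
    apply Subtype.ext
    funext i
    exact congrFun h (p, i)
  refine ⟨U.image F, ?_, ?_⟩
  · rw [Finset.card_image_of_injective _ hF]
    simpa [ZMod.card] using hU
  · intro x hx x' hx' hne a
    obtain ⟨u, hu, rfl⟩ := Finset.mem_image.1 hx
    obtain ⟨u', hu', rfl⟩ := Finset.mem_image.1 hx'
    obtain ⟨p, hp, hc⟩ := hgood u hu u' hu' (fun h => hne (by rw [h])) a
    have hc' := congrArg Subtype.val (e.injective hc)
    simp only at hc'
    have hp' : (u p).1 ≠ (u' p).1 := fun h => hp (Subtype.ext h)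
    obtain ⟨i, hi⟩ := Function.ne_iff.1 hp'
    have hia : (u p).1 i = a ↔ (u' p).1 i = a := by
      have := Finset.ext_iff.1 hc' i
      simpa using this
    refine ⟨(p, i), hi, ?_, ?_⟩
    · intro h
      exact hi (h.trans (hia.1 h).symm)
    · intro h
      exact hi ((hia.2 h).trans h.symm)

lemma power_code {κ : Type} [Fintype κ] {t : ℕ} (ht : 1 ≤ t) (X : Finset (κ → Fin t))
    (hX : GoodCode X) (s k : ℕ) (hk : s * Fintype.card κ ≤ k) :
    ∃ Y : Finset (Fin k → Fin t), Y.card = X.card ^ s ∧ GoodCode Y := by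
  classical
  have hne : Nonempty (Fin s × κ ↪ Fin k) := by
    apply Function.Embedding.nonempty_of_card_le
    simpa using hk
  obtain ⟨e⟩ := hne
  let F : (Fin s → κ → Fin t) → (Fin k → Fin t) := fun y =>
    Function.extend e (fun z => y z.1 z.2) (fun _ => ⟨0, ht⟩)
  have hFe : ∀ y j z, F y (e (j, z)) = y j z := fun y j z => e.injective.extend_apply _ _ _
  have hF : Function.Injective F := by
    intro y y' h
    funext j z
    rw [← hFe y, ← hFe y', h]
  refine ⟨(Fintype.piFinset (fun _ : Fin s => X)).image F, ?_, ?_⟩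
  · rw [Finset.card_image_of_injective _ hF]
    simp
  · intro x hx x' hx' hne a
    obtain ⟨u, hu, rfl⟩ := Finset.mem_image.1 hx
    obtain ⟨u', hu', rfl⟩ := Finset.mem_image.1 hx'
    rw [Fintype.mem_piFinset] at hu hu'
    have : u ≠ u' := fun h => hne (by rw [h])
    obtain ⟨j, hj⟩ := Function.ne_iff.1 this
    obtain ⟨i, h⟩ := hX _ (hu j) _ (hu' j) hj a
    exact ⟨e (j, i), by simpa only [hFe] using h⟩

open Filter Topology in
lemma exists_r (t : ℕ) (ht : 1 ≤ t) (δ : ℝ) (hδ : 0 < δ) :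
    ∃ r : ℕ, 1 ≤ r ∧ (t : ℝ) * Real.log ((t * r : ℕ) : ℝ) ≤ δ * ((t * r : ℕ) : ℝ) := by
  have h0 : (Real.log) =o[atTop] (id : ℝ → ℝ) := Real.isLittleO_log_id_atTop
  have ht' : (0 : ℝ) < t := by exact_mod_cast ht
  have h1 := (h0.bound (div_pos hδ ht'))
  have h2 : Tendsto (fun r : ℕ => ((t * r : ℕ) : ℝ)) atTop atTop := by
    apply tendsto_natCast_atTop_atTop.comp
    exact tendsto_id.const_mul_atTop' (by omega)
  obtain ⟨r, hr, hr1⟩ := ((h2.eventually h1).and (eventually_ge_atTop 1)).exists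
  refine ⟨r, hr1, ?_⟩
  simp only [id, Real.norm_eq_abs] at hr
  have h3 := (le_abs_self _).trans hr
  rw [abs_of_nonneg (Nat.cast_nonneg _)] at h3
  calc _ ≤ (t : ℝ) * (δ / t * ((t * r : ℕ) : ℝ)) := mul_le_mul_of_nonneg_left h3 ht'.le
    _ = _ := by field_simp

open Filter Topology in
lemma exists_n (t : ℕ) (δ : ℝ) (hδ : 0 < δ) :
    ∃ n : ℕ, 1 ≤ n ∧ ((n : ℝ) + 1) ^ t ≤ (1 + δ) * (n : ℝ) ^ t := by
  have h : Tendsto (fun n : ℕ => (1 + 1 / (n : ℝ)) ^ t) atTop (𝓝 ((1 + 0) ^ t)) :=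
    (tendsto_const_nhds.add tendsto_one_div_atTop_nhds_zero_nat).pow t
  have h2 : (1 + 0 : ℝ) ^ t < 1 + δ := by simp [hδ]
  obtain ⟨n, hn, hn1⟩ := ((h.eventually (gt_mem_nhds h2)).and (eventually_ge_atTop 1)).exists
  refine ⟨n, hn1, ?_⟩
  have hn0 : (0 : ℝ) < n := by exact_mod_cast hn1
  calc ((n : ℝ) + 1) ^ t = (1 + 1 / (n : ℝ)) ^ t * (n : ℝ) ^ t := by
        rw [← mul_pow]; congr 1; field_simp; 
    _ ≤ _ := mul_le_mul_of_nonneg_right hn.le (by positivity)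

lemma good_base (t : ℕ) (ht : 3 ≤ t) (ε : ℝ) (hε : 0 < ε) :
    ∃ (κ : Type) (_ : Fintype κ) (X : Finset (κ → Fin t)), GoodCode X ∧ 0 < Fintype.card κ ∧
      0 < X.card ∧
      (((t : ℝ) - 1) / t - ε) * Fintype.card κ * Real.log ((t : ℝ) - 1) ≤ Real.log X.card := by
  have ht3 : (3 : ℝ) ≤ t := by exact_mod_cast ht
  have hL : 0 < Real.log ((t : ℝ) - 1) := Real.log_pos (by linarith)
  have hLt : 0 < Real.log (t : ℝ) := Real.log_pos (by linarith)
  obtain ⟨r, hr, hr'⟩ := exists_r t (by omega) (ε / 2 * Real.log ((t : ℝ) - 1)) (by positivity)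
  obtain ⟨n, hn, hn'⟩ := exists_n t (ε / 2 * Real.log ((t : ℝ) - 1) / Real.log t) (by positivity)
  obtain ⟨X, hX, hgood⟩ := base_code t r n (by omega)
  have hb := bal_lower t r (by omega) hr
  have hrm : r ≤ t * r := Nat.le_mul_of_pos_left _ (by omega)
  have hc := choose_bound (t - 1) (t * r) r hrm
  rw [Nat.sub_add_cancel (by omega : 1 ≤ t)] at hc
  have hN : 0 < (t * r).choose r := Nat.choose_pos hrm
  have hm : 0 < t * r := by omega
  have hB : 0 < Fintype.card (Bal t r) := by
    rcases Nat.eq_zero_or_pos (Fintype.card (Bal t r)) with h | h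
    · rw [h] at hb
      have : 0 < t ^ (t * r) := by positivity
      omega
    · exact h
  have hXpos : 0 < X.card := by
    rcases Nat.eq_zero_or_pos X.card with h | h
    · rw [h] at hX
      have : 0 < Fintype.card (Bal t r) ^ (n ^ t) := by positivity
      omega
    · exact h
  refine ⟨_, inferInstance, X, hgood, ?_, hXpos, ?_⟩
  · simp only [Fintype.card_prod, Fintype.card_fun, Fintype.card_fin]
    positivity
  simp only [Fintype.card_prod, Fintype.card_fun, Fintype.card_fin]
  set N := (t * r).choose r with hNdef
  set B := Fintype.card (Bal t r) with hBdef
  have hX' : ((n : ℝ) ^ t) * Real.log B ≤ Real.log X.card + ((n : ℝ) + 1) ^ t * Real.log N := by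
    have h : ((B : ℝ)) ^ (n ^ t) ≤ X.card * (N : ℝ) ^ ((n + 1) ^ t) := by exact_mod_cast hX
    have h2 := Real.log_le_log (by positivity) h
    rw [Real.log_mul (by positivity) (by positivity), Real.log_pow, Real.log_pow] at h2
    push_cast at h2
    exact h2
  have hb' : ((t * r : ℕ) : ℝ) * Real.log t ≤ Real.log B + t * Real.log ((t * r : ℕ) : ℝ) := by
    have h : (t : ℝ) ^ (t * r) ≤ B * ((t * r : ℕ) : ℝ) ^ t := by exact_mod_cast hb
    have h2 := Real.log_le_log (by positivity) h
    rwa [Real.log_mul (by positivity) (by positivity), Real.log_pow, Real.log_pow] at h2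
  have hc' : Real.log N + (((t : ℝ) - 1) * r) * Real.log ((t : ℝ) - 1) ≤
      ((t * r : ℕ) : ℝ) * Real.log t := by
    have ht1 : ((t - 1 : ℕ) : ℝ) = (t : ℝ) - 1 := by rw [Nat.cast_sub (by omega)]; simp
    have htp : (0 : ℝ) < (t : ℝ) - 1 := by linarith
    have h : (N : ℝ) * ((t : ℝ) - 1) ^ (t * r - r) ≤ (t : ℝ) ^ (t * r) := by
      rw [← ht1]; exact_mod_cast hc
    have h2 := Real.log_le_log (by positivity) h
    rw [Real.log_mul (by positivity) (by positivity), Real.log_pow, Real.log_pow,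
      Nat.cast_sub hrm] at h2
    push_cast at h2 ⊢
    linarith
  push_cast at *
  set L := Real.log ((t : ℝ) - 1)
  set l := Real.log (t : ℝ)
  have hr0 : (0 : ℝ) < r := by exact_mod_cast hr
  have hn0 : (0 : ℝ) < (n : ℝ) ^ t := by
    have : (0 : ℝ) < n := by exact_mod_cast hn
    positivity
  have hNl : Real.log N ≤ t * r * l := by
    have : 0 ≤ (((t : ℝ) - 1) * r) * L := by
      have : (0 : ℝ) ≤ (t : ℝ) - 1 := by linarith
      positivity
    linarith
  have hN0 : 0 ≤ Real.log N := Real.log_natCast_nonneg _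
  set P := (n : ℝ) ^ t
  have e1 : ((n : ℝ) + 1) ^ t * Real.log N ≤ P * Real.log N + ε / 2 * L * P * (t * r) := by
    calc _ ≤ ((1 + ε / 2 * L / l) * P) * Real.log N := mul_le_mul_of_nonneg_right hn' hN0
      _ = P * Real.log N + (ε / 2 * L / l * P) * Real.log N := by ring
      _ ≤ P * Real.log N + (ε / 2 * L / l * P) * (t * r * l) := by gcongr
      _ = _ := by field_simp
  have e2 : P * (((t : ℝ) - 1) * r * L - ε / 2 * L * (t * r)) ≤
      P * (Real.log B - Real.log N) := by
    apply mul_le_mul_of_nonneg_left _ hn0.le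
    linarith
  have e3 : (((t : ℝ) - 1) / t - ε) * (P * (t * r)) * L =
      P * (((t : ℝ) - 1) * r * L - ε / 2 * L * (t * r)) - ε / 2 * L * P * (t * r) := by
    have : (t : ℝ) ≠ 0 := by linarith
    field_simp
    ring
  rw [e3]
  linarith

theorem stmt_5 (t : ℕ) (ht : 3 ≤ t) (ε : ℝ) (hε : 0 < ε) :
    ∃ k₀ : ℕ, ∀ k : ℕ, k₀ ≤ k →
      ∃ X : Finset (Fin k → Fin t),
        ((t : ℝ) - 1) ^ (((((t : ℝ) - 1) / t) - ε) * k) ≤ (X.card : ℝ) ∧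
        ∀ x ∈ X, ∀ x' ∈ X, x ≠ x' → ∀ a : Fin t,
          ∃ i : Fin k, x i ≠ x' i ∧ x i ≠ a ∧ x' i ≠ a := by
  have ht3 : (3 : ℝ) ≤ t := by exact_mod_cast ht
  have hL : 0 < Real.log ((t : ℝ) - 1) := Real.log_pos (by linarith)
  obtain ⟨κ, _, X, hX, hκ, hXpos, hlog⟩ := good_base t ht (ε / 2) (by positivity)
  set K := Fintype.card κ with hK
  refine ⟨⌈2 * (K : ℝ) / ε⌉₊, fun k hk => ?_⟩
  have hk' : 2 * (K : ℝ) / ε ≤ k := (Nat.le_ceil _).trans (by exact_mod_cast hk)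
  rw [div_le_iff₀ hε] at hk'
  obtain ⟨Y, hY, hgood⟩ := power_code (by omega) X hX (k / K) k (Nat.div_mul_le_self k K)
  refine ⟨Y, ?_, hgood⟩
  have hYpos : (0 : ℝ) < Y.card := by rw [hY]; positivity
  rw [Real.rpow_def_of_pos (by linarith), ← Real.le_log_iff_exp_le hYpos, hY, Nat.cast_pow,
    Real.log_pow]
  have h1 : ((k / K : ℕ) : ℝ) * K ≤ k := by exact_mod_cast Nat.div_mul_le_self k K
  have h2 : (k : ℝ) ≤ ((k / K : ℕ) : ℝ) * K + K := by
    have := Nat.lt_div_mul_add hκ (a := k)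
    exact_mod_cast this.le
  set s : ℝ := ((k / K : ℕ) : ℝ)
  have hs : 0 ≤ s := Nat.cast_nonneg _
  have hα : ((t : ℝ) - 1) / t ≤ 1 := by rw [div_le_one (by linarith)]; linarith
  set α := ((t : ℝ) - 1) / t
  have h3 : (α - ε) * k ≤ (α - ε / 2) * (s * K) := by
    have hK0 : (0 : ℝ) ≤ K := Nat.cast_nonneg _
    rcases le_total (α - ε / 2) 0 with h | h
    · nlinarith [mul_nonneg (neg_nonneg.2 h) (sub_nonneg.2 h1),
        mul_nonneg hε.le (Nat.cast_nonneg (α := ℝ) k)]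
    · nlinarith [mul_nonneg h (sub_nonneg.2 h2), mul_nonneg (by linarith : 0 ≤ 1 - (α - ε / 2)) hK0]
  calc _ ≤ Real.log ((t : ℝ) - 1) * ((α - ε / 2) * (s * K)) := mul_le_mul_of_nonneg_left h3 hL.le
    _ = s * ((α - ε / 2) * K * Real.log ((t : ℝ) - 1)) := by ring
    _ ≤ _ := mul_le_mul_of_nonneg_left hlog hs
end

section
/- For every t ≥ 3, rsat_t(n, K₃) ≤ (1+o(1)) · t/((t−1)·log(t−1)) · n · log n, where rsat_t(n, K₃) is the minimum number of edges in a t-edge-colored graph on n vertices with no rainbow triangle such that adding any missing edge in any of the t colors creates a rainbow triangle. -/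
/-- An edge-colored graph has a rainbow triangle if it has three mutually
adjacent vertices whose three connecting edges receive pairwise distinct colors. -/
def HasRainbowTriangle {V : Type*} (G : SimpleGraph V) {t : ℕ}
    (c : Sym2 V → Fin t) : Prop :=
  ∃ u v w : V, G.Adj u v ∧ G.Adj v w ∧ G.Adj u w ∧
    c s(u, v) ≠ c s(v, w) ∧ c s(u, v) ≠ c s(u, w) ∧ c s(v, w) ≠ c s(u, w)

/-- A `t`-edge-colored graph is rainbow-triangle-saturated if it has no rainbow
triangle, but adding any missing edge in any of the `t` colors creates one. -/
def RainbowTriangleSaturated {V : Type*} [DecidableEq V] (G : SimpleGraph V) {t : ℕ}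
    (c : Sym2 V → Fin t) : Prop :=
  ¬ HasRainbowTriangle G c ∧
  ∀ v w : V, v ≠ w → ¬ G.Adj v w → ∀ a : Fin t,
    HasRainbowTriangle (G ⊔ SimpleGraph.fromEdgeSet {s(v, w)})
      (Function.update c s(v, w) a)

/-- The rainbow saturation number for triangles: the minimum number of edges of
a `t`-edge-colored rainbow-triangle-saturated graph on `n` vertices. -/
noncomputable def rsatTriangle (t n : ℕ) : ℕ :=
  sInf { m | ∃ (G : SimpleGraph (Fin n)) (c : Sym2 (Fin n) → Fin t),
    RainbowTriangleSaturated G c ∧ G.edgeSet.ncard = m }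


/-- Two words are separated for the color `a`. -/
def SepW {t : ℕ} {I : Type} (a : Fin t) (x y : I → Fin t) : Prop :=
  ∃ i, x i ≠ y i ∧ x i ≠ a ∧ y i ≠ a

/-- Labelings of blocks. -/
def LabP {t : ℕ} (A : Type) (R : Fin t → A → A → Prop) (S : Finset (Fin t)) (N L : ℕ) : Prop :=
  ∃ (I : Type) (_ : Fintype I), Fintype.card I = N ∧ ∃ lam : (I → A) → Fin L,
    ∀ x y, x ≠ y → lam x = lam y → ∀ a ∈ S, ∃ i, R a (x i) (y i)

lemma labP_merge {t : ℕ} {A : Type} {R : Fin t → A → A → Prop} {S : Finset (Fin t)} {N L K r : ℕ}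
    (h : LabP A R S N L) (hL : 0 < L) (hKL : K ^ N ≤ L)
    (c : Fin t) (kap : A → Fin K) (hk : ∀ x y, x ≠ y → kap x = kap y → R c x y) :
    LabP A R (insert c S) (r * N) (L ^ (r + 1)) := by
  classical
  obtain ⟨I, _, hI, lam, hlam⟩ := h
  have : NeZero L := ⟨hL.ne'⟩
  -- second labeling
  have hcard : Fintype.card (I → Fin K) ≤ Fintype.card (Fin L) := by
    simp [hI, hKL]
  obtain ⟨emb⟩ := Function.Embedding.nonempty_of_card_le hcard
  let mu : (I → A) → Fin L := fun x => emb (fun i => kap (x i))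
  have hmu : ∀ x y, x ≠ y → mu x = mu y → ∃ i, R c (x i) (y i) := by
    intro x y hxy h
    obtain ⟨i, hi⟩ := Function.ne_iff.mp hxy
    exact ⟨i, hk _ _ hi (congrFun (emb.injective h) i)⟩
  let blk : (Fin r × I → A) → Fin r → (I → A) := fun x j i => x (j, i)
  let lam' : (Fin r × I → A) → ℕ → Fin L := fun x j =>
    if h : j < r then lam (blk x ⟨j, h⟩) else 0
  let mu' : (Fin r × I → A) → ℕ → Fin L := fun x j =>
    if h : 0 < j ∧ j - 1 < r then mu (blk x ⟨j - 1, h.2⟩) else 0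
  let Lam : (Fin r × I → A) → (Fin (r + 1) → Fin L) := fun x j => lam' x j - mu' x j
  let e : (Fin (r + 1) → Fin L) ≃ Fin (L ^ (r + 1)) := finFunctionFinEquiv
  refine ⟨Fin r × I, inferInstance, by simp [hI], fun x => e (Lam x), ?_⟩
  intro x y hxy hl
  have hl : Lam x = Lam y := e.injective hl
  let D : Finset (Fin r) := Finset.univ.filter fun j => blk x j ≠ blk y j
  have hD : D.Nonempty := by
    obtain ⟨⟨j, i⟩, hi⟩ := Function.ne_iff.mp hxy
    refine ⟨j, ?_⟩
    simp only [D, Finset.mem_filter, Finset.mem_univ, true_and]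
    intro h
    exact hi (congrFun h i)
  have memD : ∀ j, j ∈ D ↔ blk x j ≠ blk y j := by simp [D]
  intro a ha
  rcases Finset.mem_insert.mp ha with rfl | ha
  · -- last difference
    let j := D.max' hD
    have hj : j ∈ D := D.max'_mem hD
    have hlater : ∀ j', j < j' → blk x j' = blk y j' := by
      intro j' h
      by_contra hne
      exact absurd (D.le_max' j' ((memD j').2 hne)) (not_le.mpr h)
    have h1 : lam' x (j + 1) = lam' y (j + 1) := by
      simp only [lam']
      split_ifs with h
      · rw [hlater ⟨j + 1, h⟩ (by simp [Fin.lt_def])]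
      · rfl
    have h2 := congrFun hl ⟨j + 1, by omega⟩
    simp only [Lam] at h2
    rw [h1] at h2
    have h3 := sub_right_injective h2
    have h4 : mu (blk x j) = mu (blk y j) := by
      simpa [mu', j.2] using h3
    obtain ⟨i, hi⟩ := hmu _ _ ((memD j).1 hj) h4
    exact ⟨(j, i), hi⟩
  · let j := D.min' hD
    have hj : j ∈ D := D.min'_mem hD
    have hearly : ∀ j', j' < j → blk x j' = blk y j' := by
      intro j' h
      by_contra hne
      exact absurd (D.min'_le j' ((memD j').2 hne)) (not_le.mpr h)
    have h1 : mu' x j = mu' y j := by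
      simp only [mu']
      split_ifs with h
      · rw [hearly ⟨j - 1, h.2⟩ (by simp only [Fin.lt_def]; omega)]
      · rfl
    have h2 := congrFun hl ⟨j, by omega⟩
    simp only [Lam] at h2
    rw [h1] at h2
    have h3 := sub_left_injective h2
    have h4 : lam (blk x j) = lam (blk y j) := by
      simpa [lam', j.2] using h3
    obtain ⟨i, hi⟩ := hlam _ _ ((memD j).1 hj) h4 a ha
    exact ⟨(j, i), hi⟩

lemma labP_all {t : ℕ} {A : Type} {R : Fin t → A → A → Prop} {K : ℕ} (hK : 0 < K) (r : ℕ)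
    (kap : Fin t → A → Fin K) (hk : ∀ c x y, x ≠ y → kap c x = kap c y → R c x y)
    (S : Finset (Fin t)) :
    LabP A R S (r ^ S.card) (K ^ ((r + 1) ^ S.card)) := by
  classical
  induction S using Finset.induction_on with
  | empty =>
    refine ⟨Unit, inferInstance, by simp, fun _ => ⟨0, by simpa using hK⟩, ?_⟩
    simp
  | insert c S hc ih =>
    have := labP_merge (r := r) (K := K) ih (by positivity)
      (Nat.pow_le_pow_right hK (Nat.pow_le_pow_left (by omega) _)) c (kap c) (hk c)
    rw [Finset.card_insert_of_notMem hc, pow_succ, pow_succ, pow_mul, mul_comm (r ^ _)]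
    exact this

/-- Balanced words. -/
def BalW (t k : ℕ) : Type :=
  {w : Fin t × Fin k → Fin t // ∀ a, (Finset.univ.filter fun i => w i = a).card = k}

noncomputable instance (t k : ℕ) : Fintype (BalW t k) := by
  classical
  unfold BalW
  infer_instance

lemma balW_card (t k : ℕ) : (t * k).factorial ≤ Fintype.card (BalW t k) * k.factorial ^ t := by
  classical
  let w0 : Fin t × Fin k → Fin t := Prod.fst
  have hw0 : ∀ a, (Finset.univ.filter fun i => w0 i = a).card = k := by
    intro a
    have : (Finset.univ.filter fun i => w0 i = a) = Finset.univ.map ⟨fun j : Fin k => (a, j), fun _ _ h => by simpa using h⟩ := by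
      ext ⟨p, q⟩
      simp only [w0, Finset.mem_filter, Finset.mem_univ, true_and, Finset.mem_map]
      exact ⟨fun h => ⟨q, by cases h; rfl⟩, fun ⟨_, h⟩ => (congrArg Prod.fst h).symm⟩
    rw [this]; simp
  let F : Equiv.Perm (Fin t × Fin k) → BalW t k := fun s => ⟨w0 ∘ s, by
    intro a
    refine Eq.trans ?_ (hw0 a)
    refine Finset.card_bij (fun i _ => s i) (by simp) (by simp) ?_
    intro b hb
    exact ⟨s.symm b, by simpa using hb, by simp⟩⟩
  have h1 : (Finset.univ : Finset (Equiv.Perm (Fin t × Fin k))).card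
      ≤ k.factorial ^ t * (Finset.univ : Finset (BalW t k)).card := by
    refine Finset.card_le_mul_card_image_of_maps_to (f := F) (fun _ _ => Finset.mem_univ _) _ ?_
    intro b _
    by_cases hb : ∃ τ, F τ = b
    · obtain ⟨τ, rfl⟩ := hb
      have h2 := DomMulAct.stabilizer_card w0
      have h3 : ∀ i, Fintype.card {a // w0 a = i} = k := by
        intro i
        rw [Fintype.card_subtype]; exact hw0 i
      simp only [h3, Finset.prod_const, Finset.card_univ, Fintype.card_fin] at h2
      rw [← h2, Fintype.card_subtype]
      refine Finset.card_le_card_of_injOn (fun s => τ.symm.trans s) ?_ ?_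
      · intro s hs
        have hs' : w0 ∘ s = w0 ∘ τ := by
          have := (Finset.mem_filter.mp hs).2
          exact congrArg Subtype.val this
        simp only [Finset.coe_filter, Finset.mem_univ, true_and, Set.mem_ofPred_eq]
        funext i
        have := congrFun hs' (τ.symm i)
        simpa using this
      · intro s _ s' _ h
        ext1 i
        have := congrArg (fun g : Equiv.Perm _ => g (τ i)) h
        simpa using this
    · have : (Finset.univ.filter fun s => F s = b) = ∅ := by
        ext s; simp; exact fun h => hb ⟨s, h⟩
      rw [this]; simp
  simp only [Finset.card_univ, Fintype.card_perm, Fintype.card_prod, Fintype.card_fin] at h1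
  rw [mul_comm (Fintype.card _)]; exact h1

lemma code_exists (t k r : ℕ) (ht : 0 < t) :
    ∃ (I : Type) (_ : Fintype I) (C : Finset (I → Fin t)),
      Fintype.card I = r ^ t * (t * k) ∧
      Fintype.card (BalW t k) ^ (r ^ t) ≤ (Nat.choose (t * k) k) ^ ((r + 1) ^ t) * C.card ∧
      ∀ x ∈ C, ∀ y ∈ C, x ≠ y → ∀ a, SepW a x y := by
  classical
  have hK' : 0 < Nat.choose (t * k) k := Nat.choose_pos (Nat.le_mul_of_pos_left k ht)
  let PS := {s : Finset (Fin t × Fin k) // s ∈ Finset.powersetCard k Finset.univ}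
  have hcard : Fintype.card PS = Nat.choose (t * k) k := by
    simp [PS]
  let e : PS ≃ Fin (Nat.choose (t * k) k) := Fintype.equivFinOfCardEq hcard
  let kap : Fin t → BalW t k → Fin (Nat.choose (t * k) k) := fun a w =>
    e ⟨Finset.univ.filter fun i => w.1 i = a, by
      rw [Finset.mem_powersetCard]; exact ⟨Finset.subset_univ _, w.2 a⟩⟩
  have hk : ∀ c x y, x ≠ y → kap c x = kap c y → SepW c x.1 y.1 := by
    intro c x y hxy h
    have h := congrArg Subtype.val (e.injective h)
    simp only at h
    have hne : x.1 ≠ y.1 := fun h => hxy (Subtype.ext h)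
    obtain ⟨i, hi⟩ := Function.ne_iff.mp hne
    have h5 : x.1 i = c ↔ y.1 i = c := by
      have := Finset.ext_iff.mp h i
      simpa using this
    refine ⟨i, hi, ?_, ?_⟩
    · intro h6; exact hi (h6.trans (h5.1 h6).symm)
    · intro h6; exact hi ((h5.2 h6).trans h6.symm)
  have hlab := labP_all (R := fun c x y => SepW c x.1 y.1) hK' r kap hk Finset.univ
  rw [Finset.card_univ, Fintype.card_fin] at hlab
  obtain ⟨I, _, hI, lam, hlam⟩ := hlab
  obtain ⟨b, -, hb⟩ : ∃ b ∈ (Finset.univ : Finset (Fin (Nat.choose (t * k) k ^ (r + 1) ^ t))),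
      Fintype.card (BalW t k) ^ (r ^ t) ≤ (Nat.choose (t * k) k) ^ ((r + 1) ^ t) *
        (Finset.univ.filter fun x => lam x = b).card := by
    by_contra hcon
    push Not at hcon
    have h7 := Finset.card_eq_sum_card_fiberwise (f := lam) (s := Finset.univ) (t := Finset.univ) (by simp)
    have hpos : 0 < (Nat.choose (t * k) k) ^ ((r + 1) ^ t) := by positivity
    have : Nonempty (Fin (Nat.choose (t * k) k ^ (r + 1) ^ t)) := ⟨⟨0, hpos⟩⟩
    have h8 := Finset.sum_lt_sum_of_nonempty Finset.univ_nonempty hcon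
    rw [← Finset.mul_sum, ← h7] at h8
    simp [hI] at h8
  let fl : (I → BalW t k) → (I × (Fin t × Fin k) → Fin t) := fun x p => (x p.1).1 p.2
  have hfl : Function.Injective fl := by
    intro x y h
    funext i
    apply Subtype.ext
    funext j
    exact congrFun h (i, j)
  refine ⟨I × (Fin t × Fin k), inferInstance, (Finset.univ.filter fun x => lam x = b).image fl, ?_, ?_, ?_⟩
  · simp only [Fintype.card_prod, Fintype.card_fin, hI]
  · rw [Finset.card_image_of_injective _ hfl]; exact hb
  · intro x hx y hy hxy a
    obtain ⟨x, hxm, rfl⟩ := Finset.mem_image.mp hx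
    obtain ⟨y, hym, rfl⟩ := Finset.mem_image.mp hy
    have hx := (Finset.mem_filter.mp hxm).2
    have hy := (Finset.mem_filter.mp hym).2
    obtain ⟨i, j, hj⟩ := hlam x y (fun h => hxy (by rw [h])) (hx.trans hy.symm) a (Finset.mem_univ _)
    exact ⟨(i, j), hj⟩

lemma sat_exists {n t : ℕ} (ht : 0 < t) (core : Finset (Fin n)) (f : Fin n → Fin n → Fin t)
    (hf : ∀ x y, x ∉ core → y ∉ core → x ≠ y → ∀ a, ∃ u ∈ core,
      f x u ≠ f y u ∧ f x u ≠ a ∧ f y u ≠ a) :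
    ∃ (G : SimpleGraph (Fin n)) (c : Sym2 (Fin n) → Fin t),
      RainbowTriangleSaturated G c ∧ ∀ v w, G.Adj v w → v ∈ core ∨ w ∈ core := by
  classical
  let good : SimpleGraph (Fin n) → (Sym2 (Fin n) → Fin t) → Prop := fun G c =>
    ¬ HasRainbowTriangle G c ∧ (∀ v w, G.Adj v w → v ∈ core ∨ w ∈ core) ∧
    (∀ x u, x ∉ core → u ∈ core → G.Adj x u ∧ c s(x, u) = f x u)
  have hex : ∃ G, ∃ c, good G c := by
    let G0 : SimpleGraph (Fin n) :=
      { Adj := fun v w => (v ∈ core ∧ w ∉ core) ∨ (w ∈ core ∧ v ∉ core)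
        symm := ⟨fun v w h => h.symm⟩
        loopless := ⟨fun v h => by tauto⟩ }
    let c0 : Sym2 (Fin n) → Fin t := Sym2.lift ⟨fun v w =>
      if v ∈ core ∧ w ∉ core then f w v else if w ∈ core ∧ v ∉ core then f v w else ⟨0, ht⟩, by
        intro v w
        dsimp only
        split_ifs <;> first | rfl | tauto⟩
    refine ⟨G0, c0, ?_, ?_, ?_⟩
    · rintro ⟨u, v, w, h1, h2, h3, -⟩
      simp only [G0] at h1 h2 h3
      tauto
    · intro v w h
      simp only [G0] at h
      tauto
    · intro x u hx hu
      refine ⟨Or.inr ⟨hu, hx⟩, ?_⟩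
      simp [c0, hx, hu]
  obtain ⟨G, ⟨c, hc⟩, hmax⟩ :=
    (Set.toFinite {G : SimpleGraph (Fin n) | ∃ c, good G c}).exists_maximal hex
  refine ⟨G, c, ⟨hc.1, ?_⟩, hc.2.1⟩
  intro v w hvw hnadj a
  by_cases hv : v ∈ core
  · by_cases hw : w ∈ core
    · by_contra hno
      have hle : G ⊔ SimpleGraph.fromEdgeSet {s(v, w)} ≤ G := by
        refine hmax ⟨Function.update c s(v, w) a, hno, ?_, ?_⟩ le_sup_left
        · intro p q hpq
          rcases hpq with h | h
          · exact hc.2.1 p q h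
          · simp at h
            rcases h.1 with ⟨rfl, rfl⟩ | ⟨rfl, rfl⟩ <;> simp [hv]
        · intro x u hx hu
          refine ⟨Or.inl (hc.2.2 x u hx hu).1, ?_⟩
          rw [Function.update_of_ne, (hc.2.2 x u hx hu).2]
          intro h
          rw [Sym2.eq_iff] at h
          rcases h with ⟨rfl, rfl⟩ | ⟨rfl, rfl⟩ <;> exact hx ‹_›
      exact hnadj (hle (Or.inr (by simp [hvw])))
    · exact absurd (hc.2.2 w v hw hv).1.symm hnadj
  · by_cases hw : w ∈ core
    · exact absurd (hc.2.2 v w hv hw).1 hnadj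
    · obtain ⟨u, hu, h1, h2, h3⟩ := hf v w hv hw hvw a
      have e1 := hc.2.2 v u hv hu
      have e2 := hc.2.2 w u hw hu
      have n1 : u ≠ v := fun h => hv (h ▸ hu)
      have n2 : u ≠ w := fun h => hw (h ▸ hu)
      refine ⟨v, u, w, Or.inl e1.1, Or.inl e2.1.symm, Or.inr (by simp [hvw]), ?_⟩
      have k1 : Function.update c s(v, w) a s(v, u) = f v u := by
        rw [Function.update_of_ne, e1.2]
        simp; tauto
      have k2 : Function.update c s(v, w) a s(u, w) = f w u := by
        rw [Function.update_of_ne, Sym2.eq_swap, e2.2]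
        simp; tauto
      rw [k1, k2, Function.update_self]
      exact ⟨h1, h2, h3⟩

lemma rsat_le {n t m : ℕ} (ht : 0 < t) (hmn : m ≤ n) (word : Fin n → (Fin m → Fin t))
    (hw : ∀ x y, x ≠ y → ∀ a, SepW a (word x) (word y)) :
    rsatTriangle t n ≤ n * m := by
  classical
  let core : Finset (Fin n) := Finset.univ.map (Fin.castLEEmb hmn)
  let f : Fin n → Fin n → Fin t := fun x u => if h : u.1 < m then word x ⟨u, h⟩ else ⟨0, ht⟩
  obtain ⟨G, c, hs, hE⟩ := sat_exists ht core f (by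
    intro x y _ _ hxy a
    obtain ⟨i, hi⟩ := hw x y hxy a
    refine ⟨Fin.castLE hmn i, by simp [core], ?_⟩
    simpa [f] using hi)
  refine le_trans (Nat.sInf_le (m := G.edgeSet.ncard) ⟨G, c, hs, rfl⟩) ?_
  let E : Finset (Sym2 (Fin n)) := (Finset.univ ×ˢ core).image fun p => s(p.1, p.2)
  have hsub : G.edgeSet ⊆ (E : Set (Sym2 (Fin n))) := by
    intro e
    induction e using Sym2.ind with
    | _ v w =>
      intro h
      simp only [E, Finset.coe_image, Set.mem_image, Finset.mem_coe, Finset.mem_product, Finset.mem_univ, true_and]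
      rcases hE v w h with h | h
      · exact ⟨(w, v), h, Sym2.eq_swap⟩
      · exact ⟨(v, w), h, rfl⟩
  calc G.edgeSet.ncard ≤ (E : Set (Sym2 (Fin n))).ncard := Set.ncard_le_ncard hsub (Finset.finite_toSet _)
    _ = E.card := Set.ncard_coe_finset _
    _ ≤ (Finset.univ ×ˢ core : Finset (Fin n × Fin n)).card := Finset.card_image_le
    _ = n * m := by simp [core]

/-- power of a code -/
lemma rsat_le_of_code {t m0 n q : ℕ} (ht : 0 < t) {I : Type} [Fintype I] (hI : Fintype.card I = m0)
    (C : Finset (I → Fin t)) (hC : ∀ x ∈ C, ∀ y ∈ C, x ≠ y → ∀ a, SepW a x y)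
    (hn : n ≤ C.card ^ q) (hm : m0 * q ≤ n) : rsatTriangle t n ≤ n * (m0 * q) := by
  classical
  have hcard : Fintype.card (Fin n) ≤ Fintype.card (Fin q → C) := by simpa using hn
  obtain ⟨emb⟩ := Function.Embedding.nonempty_of_card_le hcard
  have e : Fin (m0 * q) ≃ I × Fin q := (Fintype.equivFinOfCardEq (by simp [hI])).symm
  refine rsat_le ht hm (fun x i => (emb x (e i).2).1 (e i).1) ?_
  intro x y hxy a
  obtain ⟨j, hj⟩ := Function.ne_iff.mp (emb.injective.ne hxy)
  obtain ⟨i, hi⟩ := hC _ (emb x j).2 _ (emb y j).2 (fun h => hj (Subtype.ext h)) a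
  exact ⟨e.symm (i, j), by simpa using hi⟩

lemma log_fact_lower (n : ℕ) :
    (n : ℝ) * Real.log n - n ≤ Real.log (n.factorial : ℝ) := by
  induction n with
  | zero => simp
  | succ n ih =>
    rw [Nat.factorial_succ]
    push_cast
    rw [Real.log_mul (by positivity) (by positivity)]
    rcases Nat.eq_zero_or_pos n with h | h
    · subst h; simp
    have hn : (0 : ℝ) < n := by exact_mod_cast h
    have h1 := Real.log_le_sub_one_of_pos (x := ((n : ℝ) + 1) / n) (by positivity)
    rw [Real.log_div (by positivity) (by positivity)] at h1
    have h2 : (n : ℝ) * (Real.log (n + 1) - Real.log n) ≤ n * (((n : ℝ) + 1) / n - 1) :=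
      mul_le_mul_of_nonneg_left h1 hn.le
    have h3 : (n : ℝ) * (((n : ℝ) + 1) / n - 1) = 1 := by field_simp; ring
    nlinarith

lemma log_fact_upper (n : ℕ) (hn : 1 ≤ n) :
    Real.log (n.factorial : ℝ) ≤ 1 + Real.log n + n * Real.log n - n := by
  induction n, hn using Nat.le_induction with
  | base => simp
  | succ n h ih =>
    rw [Nat.factorial_succ]
    push_cast
    rw [Real.log_mul (by positivity) (by positivity)]
    have hn : (0 : ℝ) < n := by exact_mod_cast h
    have h1 := Real.one_sub_inv_le_log_of_pos (x := ((n : ℝ) + 1) / n) (by positivity)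
    rw [Real.log_div (by positivity) (by positivity)] at h1
    have h2 : ((n : ℝ) + 1) * (1 - (((n : ℝ) + 1) / n)⁻¹) ≤
        ((n : ℝ) + 1) * (Real.log (n + 1) - Real.log n) :=
      mul_le_mul_of_nonneg_left h1 (by positivity)
    have h3 : ((n : ℝ) + 1) * (1 - (((n : ℝ) + 1) / n)⁻¹) = 1 := by field_simp; ring
    nlinarith

lemma code_rate_aux (t k r : ℕ) (ht : 3 ≤ t) (hk : 1 ≤ k) (hr : 1 ≤ r) :
    ∃ (I : Type) (_ : Fintype I) (C : Finset (I → Fin t)),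
      Fintype.card I = r ^ t * (t * k) ∧ 0 < C.card ∧
      (∀ x ∈ C, ∀ y ∈ C, x ≠ y → ∀ a, SepW a x y) ∧
      (r : ℝ) ^ t * (((t : ℝ) - 1) * k * Real.log ((t : ℝ) - 1) - (t - 1) * (1 + Real.log k))
        - (((r : ℝ) + 1) ^ t - (r : ℝ) ^ t) * (t * k) ≤ Real.log C.card := by
  obtain ⟨I, inst, C, hI, hc, hsep⟩ := code_exists t k r (by omega)
  have hT := balW_card t k
  set T := Fintype.card (BalW t k) with hTdef
  have hkt : k ≤ t * k := Nat.le_mul_of_pos_left k (by omega)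
  have hK : 0 < Nat.choose (t * k) k := Nat.choose_pos hkt
  have hTpos : 0 < T := by
    rcases Nat.eq_zero_or_pos T with h | h
    · rw [h] at hT; have := Nat.factorial_pos (t * k); omega
    · exact h
  have hCpos : 0 < C.card := by
    rcases Nat.eq_zero_or_pos C.card with h | h
    · rw [h] at hc; have : 0 < T ^ r ^ t := by positivity
      omega
    · exact h
  refine ⟨I, inst, C, hI, hCpos, hsep, ?_⟩
  obtain ⟨s, rfl⟩ : ∃ s, t = s + 1 := ⟨t - 1, by omega⟩
  have hKfac := Nat.choose_mul_factorial_mul_factorial hkt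
  have hsub : (s + 1) * k - k = s * k := by
    rw [Nat.add_mul, one_mul, Nat.add_sub_cancel]
  rw [hsub] at hKfac
  set K := Nat.choose ((s + 1) * k) k with hKdef
  have hKle : K ≤ 2 ^ ((s + 1) * k) := Nat.choose_le_two_pow _ _
  have l1 : Real.log (((s + 1) * k).factorial : ℝ) ≤ Real.log T + (s + 1) * Real.log (k.factorial : ℝ) := by
    have : (((s + 1) * k).factorial : ℝ) ≤ T * (k.factorial : ℝ) ^ (s + 1) := by exact_mod_cast hT
    have h := Real.log_le_log (by positivity) this
    rw [Real.log_mul (by positivity) (by positivity), Real.log_pow] at h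
    push_cast at h; exact h
  have l2 : Real.log K + Real.log (k.factorial : ℝ) + Real.log ((s * k).factorial : ℝ)
      = Real.log (((s + 1) * k).factorial : ℝ) := by
    rw [← hKfac]; push_cast
    rw [Real.log_mul (by positivity) (by positivity), Real.log_mul (by positivity) (by positivity)]
  have l3 : Real.log K ≤ (s + 1) * k := by
    have : (K : ℝ) ≤ 2 ^ ((s + 1) * k) := by exact_mod_cast hKle
    have h := Real.log_le_log (by positivity) this
    rw [Real.log_pow] at h
    push_cast at h
    have h2 : Real.log 2 ≤ 1 := by have := Real.log_two_lt_d9; linarith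
    have h4 : (0 : ℝ) ≤ (s + 1) * k := by positivity
    nlinarith
  have l4 : (r : ℝ) ^ (s + 1) * Real.log T ≤ ((r : ℝ) + 1) ^ (s + 1) * Real.log K + Real.log C.card := by
    have : (T : ℝ) ^ (r ^ (s + 1)) ≤ (K : ℝ) ^ ((r + 1) ^ (s + 1)) * C.card := by exact_mod_cast hc
    have h := Real.log_le_log (by positivity) this
    rw [Real.log_mul (by positivity) (by positivity), Real.log_pow, Real.log_pow] at h
    push_cast at h; exact h
  have l5 := log_fact_lower (s * k)
  have l6 := log_fact_upper k hk
  have hs : 0 < s := by omega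
  have hsk : Real.log ((s * k : ℕ) : ℝ) = Real.log s + Real.log k := by
    push_cast; rw [Real.log_mul (by positivity) (by positivity)]
  rw [hsk] at l5
  push_cast at l5 ⊢
  have e1 : ((s : ℝ) + 1 - 1) = s := by ring
  rw [e1]
  have hs' : (0 : ℝ) ≤ s := by positivity
  have l7 : (s : ℝ) * k * Real.log s - s * (1 + Real.log k) ≤ Real.log T - Real.log K := by
    have l8 := mul_le_mul_of_nonneg_left l6 hs'
    linarith
  have hd : (0 : ℝ) ≤ ((r : ℝ) + 1) ^ (s + 1) - (r : ℝ) ^ (s + 1) := by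
    have : (r : ℝ) ^ (s + 1) ≤ ((r : ℝ) + 1) ^ (s + 1) :=
      pow_le_pow_left₀ (by positivity) (by linarith) _
    linarith
  have hr' : (0 : ℝ) ≤ (r : ℝ) ^ (s + 1) := by positivity
  have m1 := mul_le_mul_of_nonneg_left l7 hr'
  have m2 := mul_le_mul_of_nonneg_left l3 hd
  linarith

lemma code_rate (t : ℕ) (ht : 3 ≤ t) (ρ : ℝ)
    (hρ : ρ < ((t : ℝ) - 1) / t * Real.log ((t : ℝ) - 1)) :
    ∃ (I : Type) (_ : Fintype I) (C : Finset (I → Fin t)),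
      0 < Fintype.card I ∧ 0 < C.card ∧
      (∀ x ∈ C, ∀ y ∈ C, x ≠ y → ∀ a, SepW a x y) ∧
      ρ * Fintype.card I ≤ Real.log C.card := by
  set R := ((t : ℝ) - 1) / t * Real.log ((t : ℝ) - 1) with hR
  set δ := (R - ρ) / 2 with hδ
  have hδ0 : 0 < δ := by rw [hδ]; linarith
  have ht' : (3 : ℝ) ≤ t := by exact_mod_cast ht
  have hk : ∀ᶠ k : ℕ in Filter.atTop, (1 + Real.log k) ≤ δ * k := by
    have h1 : ∀ᶠ x : ℝ in Filter.atTop, ‖Real.log x‖ ≤ (δ / 2) * ‖x‖ :=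
      Real.isLittleO_log_id_atTop.bound (by positivity)
    have h2 := tendsto_natCast_atTop_atTop (R := ℝ).eventually h1
    have h3 := tendsto_natCast_atTop_atTop (R := ℝ).eventually
      (Filter.eventually_ge_atTop (2 / δ))
    filter_upwards [h2, h3] with k a b
    have a1 := (le_abs_self _).trans a
    simp only [Real.norm_eq_abs, Nat.abs_cast] at a1
    rw [div_le_iff₀ hδ0] at b
    nlinarith
  have hr : ∀ᶠ r : ℕ in Filter.atTop, ((1 : ℝ) + 1 / r) ^ t ≤ 1 + δ := by
    have h1 : Filter.Tendsto (fun r : ℕ => ((1 : ℝ) + 1 / r) ^ t) Filter.atTop (nhds ((1 + 0) ^ t)) :=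
      (tendsto_const_nhds.add tendsto_one_div_atTop_nhds_zero_nat).pow t
    rw [add_zero, one_pow] at h1
    exact (h1.eventually (gt_mem_nhds (by linarith : (1 : ℝ) < 1 + δ))).mono fun _ h => h.le
  obtain ⟨k, hk, hk1⟩ := (hk.and (Filter.eventually_ge_atTop 1)).exists
  obtain ⟨r, hr, hr1⟩ := (hr.and (Filter.eventually_ge_atTop 1)).exists
  obtain ⟨I, inst, C, hI, hC, hsep, hlog⟩ := code_rate_aux t k r ht hk1 hr1
  refine ⟨I, inst, C, ?_, hC, hsep, le_trans ?_ hlog⟩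
  · rw [hI]; positivity
  rw [hI]; push_cast
  have hrpos : (0 : ℝ) < r := by exact_mod_cast hr1
  have hkpos : (0 : ℝ) < k := by exact_mod_cast hk1
  have e1 : ((r : ℝ) + 1) ^ t = (r : ℝ) ^ t * (1 + 1 / r) ^ t := by
    rw [← mul_pow]; congr 1; field_simp
  have e2 : ((t : ℝ) - 1) * k * Real.log ((t : ℝ) - 1) = R * (t * k) := by
    rw [hR]; field_simp
  rw [e1, e2]
  have hX : (0 : ℝ) < (r : ℝ) ^ t := by positivity
  have hρR : ρ = R - 2 * δ := by rw [hδ]; ring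
  have g1 : ((t : ℝ) - 1) * (1 + Real.log k) ≤ δ * (t * k) := by
    have : ((t : ℝ) - 1) * (1 + Real.log k) ≤ (t - 1) * (δ * k) :=
      mul_le_mul_of_nonneg_left hk (by linarith)
    have h0 : 0 < δ * k := by positivity
    nlinarith
  have g2 : ((1 + 1 / (r : ℝ)) ^ t - 1) * (t * k) ≤ δ * (t * k) :=
    mul_le_mul_of_nonneg_right (by linarith) (by positivity)
  have g3 : (R - 2 * δ) * (t * k) ≤ (R * (t * k) - ((t : ℝ) - 1) * (1 + Real.log k))
     - ((1 + 1 / (r : ℝ)) ^ t - 1) * (t * k) := by linarith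
  have g4 := mul_le_mul_of_nonneg_left g3 hX.le
  rw [hρR]
  linarith

theorem stmt_17 (t : ℕ) (ht : 3 ≤ t) (ε : ℝ) (hε : 0 < ε) :
    ∃ N : ℕ, ∀ n : ℕ, N ≤ n →
      (rsatTriangle t n : ℝ) ≤
        (1 + ε) * ((t : ℝ) / (((t : ℝ) - 1) * Real.log ((t : ℝ) - 1))) * n * Real.log n := by
  have ht' : (3 : ℝ) ≤ t := by exact_mod_cast ht
  have hlogt : 0 < Real.log ((t : ℝ) - 1) := Real.log_pos (by linarith)
  have ht1 : (0 : ℝ) < (t : ℝ) - 1 := by linarith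
  set R := ((t : ℝ) - 1) / t * Real.log ((t : ℝ) - 1) with hR
  have hRpos : 0 < R := by positivity
  have hRinv : (t : ℝ) / (((t : ℝ) - 1) * Real.log ((t : ℝ) - 1)) = 1 / R := by
    rw [hR]; field_simp
  rw [hRinv]
  set ρ := R / (1 + ε / 2) with hρ
  have hρpos : 0 < ρ := by positivity
  have hρR : ρ < R := by
    rw [hρ]; exact div_lt_self hRpos (by linarith)
  obtain ⟨I, inst, C, hI, hC, hsep, hlog⟩ := code_rate t ht ρ hρR
  set m0 := Fintype.card I with hm0
  have hm0' : (0 : ℝ) < m0 := by exact_mod_cast hI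
  have ev : ∀ᶠ n : ℕ in Filter.atTop, Real.log n / ρ + m0 ≤ n ∧ (m0 : ℝ) ≤ ε / 2 / R * Real.log n ∧ 1 ≤ n := by
    have h1 : ∀ᶠ x : ℝ in Filter.atTop, ‖Real.log x‖ ≤ (ρ / 2) * ‖x‖ :=
      Real.isLittleO_log_id_atTop.bound (by positivity)
    have h2 := tendsto_natCast_atTop_atTop (R := ℝ).eventually h1
    have h3 := tendsto_natCast_atTop_atTop (R := ℝ).eventually
      (Filter.eventually_ge_atTop (2 * (m0 : ℝ)))
    have h4 := (Real.tendsto_log_atTop.comp (tendsto_natCast_atTop_atTop (R := ℝ))).eventually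
      (Filter.eventually_ge_atTop ((m0 : ℝ) / (ε / 2 / R)))
    filter_upwards [h2, h3, h4, Filter.eventually_ge_atTop 1] with n a b c d
    refine ⟨?_, ?_, d⟩
    · have a1 := (le_abs_self _).trans a
      simp only [Real.norm_eq_abs, Nat.abs_cast] at a1
      have : Real.log n / ρ ≤ n / 2 := by
        rw [div_le_iff₀ hρpos]; linarith
      linarith
    · simp only [Function.comp] at c
      rw [div_le_iff₀ (by positivity)] at c
      linarith
  obtain ⟨N, hN⟩ := Filter.eventually_atTop.mp ev
  refine ⟨N, fun n hn => ?_⟩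
  obtain ⟨a, b, d⟩ := hN n hn
  have hnpos : (0 : ℝ) < n := by exact_mod_cast d
  have hlogn : 0 ≤ Real.log n := Real.log_natCast_nonneg n
  set q := ⌈Real.log n / (ρ * m0)⌉₊ with hq
  have q1 : Real.log n / (ρ * m0) ≤ q := Nat.le_ceil _
  have q2 : (q : ℝ) < Real.log n / (ρ * m0) + 1 := Nat.ceil_lt_add_one (by positivity)
  have q3 : (m0 : ℝ) * q ≤ Real.log n / ρ + m0 := by
    have := mul_le_mul_of_nonneg_left q2.le hm0'.le
    have e : (m0 : ℝ) * (Real.log n / (ρ * m0) + 1) = Real.log n / ρ + m0 := by field_simp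
    linarith
  have hCn : n ≤ C.card ^ q := by
    have hCR : (0 : ℝ) < C.card := by exact_mod_cast hC
    have : Real.log n ≤ Real.log ((C.card : ℝ) ^ q) := by
      rw [Real.log_pow]
      rw [div_le_iff₀ (by positivity)] at q1
      exact q1.trans (mul_le_mul_of_nonneg_left hlog (by positivity))
    have := (Real.log_le_log_iff hnpos (by positivity)).mp this
    exact_mod_cast this
  have hmn : m0 * q ≤ n := by
    have : (m0 : ℝ) * q ≤ n := q3.trans a
    exact_mod_cast this
  have hmain := rsat_le_of_code (by omega) hm0.symm C hsep hCn hmn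
  have hmain' : (rsatTriangle t n : ℝ) ≤ n * (m0 * q) := by exact_mod_cast hmain
  refine hmain'.trans ?_
  have e3 : Real.log n / ρ = (1 + ε / 2) * (1 / R) * Real.log n := by
    rw [hρ]; field_simp
  have e4 : ε / 2 / R * Real.log n = (ε / 2) * (1 / R) * Real.log n := by ring
  rw [e4] at b
  rw [e3] at q3
  have : (m0 : ℝ) * q ≤ (1 + ε) * (1 / R) * Real.log n := by linarith
  calc (n : ℝ) * (m0 * q) ≤ n * ((1 + ε) * (1 / R) * Real.log n) :=
        mul_le_mul_of_nonneg_left this hnpos.le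
    _ = _ := by ring
end
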